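/- Let d ≥ 2 and n ≥ 1 be integers and let t be an integer with 0 ≤ t ≤ n−1. Say two d-ary strings of length n are in the same window if they agree in their first n−t coordinates. Let a be a d-ary string of length n and let B be a nonempty finite set of d-ary strings of length n all lying in one common window. Let S be a finite set of pairs (u,v) of d-ary strings of length n such that: (i) u ≠ a and v ∉ B for every (u,v) ∈ S; (ii) distinct elements of S have distinct second components; (iii) if (u,v) and (u,v') are distinct elements of S with the same first component, then v and v' are not in the same window; and (iv) every (u,v) ∈ S satisfies suf(u_{1..n−1}, a_{1..n−1}) + pre(v_{1..n−1}, b_{1..n−1}) ≥ n−1 for some b ∈ B. Then: if 2t < n, |S| ≤ d^{n−2t} + t·(d−1)·d^{n−t} − 1; if 2t = n, |S| ≤ [ (n−t)(d−1) − 1 ]·d^{n−t} + d^t; and if 2t > n, then (as an inequality of rational numbers, where the exponent 2t−n−2 may be negative) |S| < [ (n−t)(d−1) − 1 ]·d^{n−t} + d^t − (d−1)·d^{2t−n−2} + 1. -/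

import Mathlib

/-- Length of the longest common prefix of the `(n-1)`-prefixes `s₁⋯s_{n-1}` and
`s'₁⋯s'_{n-1}` of two `d`-ary strings of length `n`: the largest `p ≤ n-1` such
that `s i = s' i` for all (0-indexed) `i < p`. -/
def strPre (d n : ℕ) (s s' : Fin n → Fin d) : ℕ :=
  ((Finset.range n).filter (fun p => ∀ i : Fin n, (i : ℕ) < p → s i = s' i)).sup id

/-- Length of the longest common suffix of the `(n-1)`-prefixes `s₁⋯s_{n-1}` and
`s'₁⋯s'_{n-1}` of two `d`-ary strings of length `n`: the largest `q ≤ n-1` such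
that `s i = s' i` for all (0-indexed) `i` with `n-1-q ≤ i < n-1`. -/
def strSuf (d n : ℕ) (s s' : Fin n → Fin d) : ℕ :=
  ((Finset.range n).filter
    (fun q => ∀ i : Fin n, n - 1 - q ≤ (i : ℕ) → (i : ℕ) < n - 1 → s i = s' i)).sup id

lemma aux_pre {d n : ℕ} (hn : 1 ≤ n) (s s' : Fin n → Fin d) :
    strPre d n s s' ≤ n - 1 ∧ ∀ i : Fin n, (i : ℕ) < strPre d n s s' → s i = s' i := by
  have hne : ((Finset.range n).filter
      (fun p => ∀ i : Fin n, (i : ℕ) < p → s i = s' i)).Nonempty :=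
    ⟨0, by simp; omega⟩
  obtain ⟨p, hp, he⟩ := Finset.exists_mem_eq_sup _ hne id
  rw [Finset.mem_filter, Finset.mem_range] at hp
  have : strPre d n s s' = p := he
  rw [this]
  exact ⟨by omega, hp.2⟩

lemma aux_suf {d n : ℕ} (hn : 1 ≤ n) (s s' : Fin n → Fin d) :
    ∀ i : Fin n, n - 1 - strSuf d n s s' ≤ (i : ℕ) → (i : ℕ) < n - 1 → s i = s' i := by
  have hne : ((Finset.range n).filter
      (fun q => ∀ i : Fin n, n - 1 - q ≤ (i : ℕ) → (i : ℕ) < n - 1 → s i = s' i)).Nonempty :=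
    ⟨0, Finset.mem_filter.2 ⟨Finset.mem_range.2 hn, fun i hi hi' => by omega⟩⟩
  obtain ⟨p, hp, he⟩ := Finset.exists_mem_eq_sup _ hne id
  rw [Finset.mem_filter, Finset.mem_range] at hp
  have : strSuf d n s s' = p := he
  rw [this]
  exact hp.2

/-- strings agreeing with `c` in the first `m` coordinates -/
def cyl {d n : ℕ} (c : Fin n → Fin d) (m : ℕ) : Finset (Fin n → Fin d) :=
  Fintype.piFinset (fun i => if (i : ℕ) < m then {c i} else Finset.univ)

lemma mem_cyl {d n : ℕ} (c f : Fin n → Fin d) (m : ℕ) :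
    f ∈ cyl c m ↔ ∀ i : Fin n, (i : ℕ) < m → f i = c i := by
  simp only [cyl, Fintype.mem_piFinset]
  refine forall_congr' fun i => ?_
  by_cases h : (i : ℕ) < m <;> simp [h]

lemma card_cyl {d n : ℕ} (c : Fin n → Fin d) (m : ℕ) (hm : m ≤ n) :
    (cyl c m).card = d ^ (n - m) := by
  rw [cyl, Fintype.card_piFinset]
  have : ∀ i : Fin n, (if (i : ℕ) < m then {c i} else (Finset.univ : Finset (Fin d))).card
      = (fun k => if k < m then 1 else d) (i : ℕ) := by
    intro i
    by_cases h : (i : ℕ) < m <;> simp [h]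
  rw [Finset.prod_congr rfl (fun i _ => this i), Fin.prod_univ_eq_prod_range
    (fun k => if k < m then 1 else d) n]
  obtain ⟨k, rfl⟩ := Nat.exists_eq_add_of_le hm
  rw [Finset.prod_range_add, Finset.prod_congr rfl (g := fun _ => 1)
    (fun x hx => by simp at hx; simp [hx])]
  simp

/-- strings agreeing with `c` before coordinate `m` and differing from `c` there -/
def lev {d n : ℕ} (c : Fin n → Fin d) (m : ℕ) : Finset (Fin n → Fin d) :=
  Fintype.piFinset (fun i => if (i : ℕ) < m then {c i} else
    if (i : ℕ) = m then Finset.univ.erase (c i) else Finset.univ)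

lemma mem_lev {d n : ℕ} (c f : Fin n → Fin d) (m : ℕ)
    (h1 : ∀ i : Fin n, (i : ℕ) < m → f i = c i) (h2 : ∀ i : Fin n, (i : ℕ) = m → f i ≠ c i) :
    f ∈ lev c m := by
  simp only [lev, Fintype.mem_piFinset]
  intro i
  by_cases h : (i : ℕ) < m
  · simp [h, h1 i h]
  · by_cases h' : (i : ℕ) = m
    · simp [h', h2 i h']
    · simp [h, h']

lemma card_lev {d n : ℕ} (c : Fin n → Fin d) (m : ℕ) (hm : m < n) :
    (lev c m).card = (d - 1) * d ^ (n - 1 - m) := by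
  rw [lev, Fintype.card_piFinset]
  have : ∀ i : Fin n, (if (i : ℕ) < m then {c i} else
    if (i : ℕ) = m then Finset.univ.erase (c i) else (Finset.univ : Finset (Fin d))).card
      = (fun k => if k < m then 1 else if k = m then d - 1 else d) (i : ℕ) := by
    intro i
    by_cases h : (i : ℕ) < m
    · simp [h]
    · by_cases h' : (i : ℕ) = m
      · simp [h']
      · simp [h, h']
  rw [Finset.prod_congr rfl (fun i _ => this i), Fin.prod_univ_eq_prod_range
    (fun k => if k < m then 1 else if k = m then d - 1 else d) n]
  obtain ⟨k, rfl⟩ := Nat.exists_eq_add_of_le (Nat.succ_le_of_lt hm)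
  rw [Finset.prod_range_add, Finset.prod_range_succ, Finset.prod_congr rfl (g := fun _ => 1)
    (fun x hx => by simp at hx; simp [hx]),
    Finset.prod_congr rfl (s₁ := Finset.range k) (g := fun _ => d)
    (fun x hx => by
      have h1 : ¬ (m.succ + x < m) := by omega
      have h2 : ¬ (m.succ + x = m) := by omega
      simp only [h1, h2, if_false])]
  have : m.succ + k - 1 - m = k := by omega
  simp [this]

/-- strings agreeing with `a` on coordinates in `[m, n-1)` -/
def ucyl {d n : ℕ} (a : Fin n → Fin d) (m : ℕ) : Finset (Fin n → Fin d) :=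
  Fintype.piFinset (fun i => if m ≤ (i : ℕ) ∧ (i : ℕ) < n - 1 then {a i} else Finset.univ)

lemma mem_ucyl {d n : ℕ} (c f : Fin n → Fin d) (m : ℕ) :
    f ∈ ucyl c m ↔ ∀ i : Fin n, m ≤ (i : ℕ) → (i : ℕ) < n - 1 → f i = c i := by
  simp only [ucyl, Fintype.mem_piFinset]
  refine forall_congr' fun i => ?_
  by_cases h : m ≤ (i : ℕ) <;> by_cases h' : (i : ℕ) < n - 1 <;> simp [h, h']

lemma card_ucyl {d n : ℕ} (a : Fin n → Fin d) (m : ℕ) (hm : m < n) :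
    (ucyl a m).card = d ^ (m + 1) := by
  rw [ucyl, Fintype.card_piFinset]
  have : ∀ i : Fin n, (if m ≤ (i : ℕ) ∧ (i : ℕ) < n - 1 then {a i}
      else (Finset.univ : Finset (Fin d))).card
      = (fun k => if m ≤ k ∧ k < n - 1 then 1 else d) (i : ℕ) := by
    intro i
    by_cases h : m ≤ (i : ℕ) ∧ (i : ℕ) < n - 1 <;> simp [h]
  rw [Finset.prod_congr rfl (fun i _ => this i), Fin.prod_univ_eq_prod_range
    (fun k => if m ≤ k ∧ k < n - 1 then 1 else d) n]
  obtain ⟨k, rfl⟩ := Nat.exists_eq_add_of_le (Nat.succ_le_of_lt hm)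
  have e : m.succ + k = m + k + 1 := by omega
  rw [e, Finset.prod_range_succ, Finset.prod_range_add, Finset.prod_congr rfl (g := fun _ => d)
    (fun x hx => by
      simp only [Finset.mem_range] at hx
      have : ¬ (m ≤ x) := by omega
      simp [this]),
    Finset.prod_congr rfl (s₁ := Finset.range k) (g := fun _ => 1)
    (fun x hx => by
      simp only [Finset.mem_range] at hx
      simp [hx])]
  simp [pow_succ]

/-- the weighted sum of window contributions -/
def FF (d : ℤ) (x : ℕ → ℤ) (N : ℕ) : ℤ :=
  ∑ j ∈ Finset.range N, x j * ((d - 1) * d ^ (N - 1 - j))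

lemma FF_succ (d : ℤ) (x : ℕ → ℤ) (N : ℕ) :
    FF d x (N + 1) = d * FF d x N + x N * (d - 1) := by
  simp only [FF]
  rw [Finset.sum_range_succ, Finset.mul_sum]
  have : N + 1 - 1 - N = 0 := by omega
  rw [this, pow_zero, mul_one]
  congr 1
  refine Finset.sum_congr rfl fun j hj => ?_
  rw [Finset.mem_range] at hj
  have : N + 1 - 1 - j = (N - 1 - j) + 1 := by omega
  rw [this, pow_succ]
  ring

lemma FF_small (d : ℤ) (t N : ℕ) (h : N ≤ t) :
    FF d (fun j => if j < t then d ^ (j + 1) - 1 else d ^ t) N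
      = N * (d - 1) * d ^ N - d ^ N + 1 := by
  induction N with
  | zero => simp [FF]
  | succ N ih =>
    rw [FF_succ, ih (by omega), if_pos (by omega)]
    push_cast
    ring

lemma FF_big (d : ℤ) (t k : ℕ) :
    FF d (fun j => if j < t then d ^ (j + 1) - 1 else d ^ t) (t + k)
      = t * (d - 1) * d ^ (t + k) + d ^ k - d ^ t := by
  induction k with
  | zero => 
    rw [add_zero, FF_small d t t le_rfl]; ring
  | succ N ih =>
    rw [← add_assoc, FF_succ, ih, if_neg (by omega)]
    ring

/-- Crosstalk-free multicast WSNB bound for the window algorithm with window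
size `d^t` (Theorem 1 of Ngo–Nguyen–Ha, Globecom 2008). Two strings are in the
same window if they agree in their first `n-t` coordinates. `B` lies in one
window, `S` is a set of pairs `(u,v)` node-blocking the request `(a,B)`
(crosstalk-free blocking: `suf + pre ≥ n-1`), with distinct second components,
and for a common first component the second components lie in distinct
windows. Then `|S| ≤ d^{n-2t} + t(d-1)d^{n-t} - 1` when `2t < n`,
`|S| ≤ [(n-t)(d-1) - 1] d^{n-t} + d^t` when `2t = n`, and (as rationals, with
possibly negative exponent `2t-n-2`)
`|S| < [(n-t)(d-1) - 1] d^{n-t} + d^t - (d-1) d^{2t-n-2} + 1` when `2t > n`. -/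
theorem stmt_19 (d n t : ℕ) (hd : 2 ≤ d) (hn : 1 ≤ n) (ht : t ≤ n - 1)
    (a : Fin n → Fin d)
    (B : Finset (Fin n → Fin d)) (hBne : B.Nonempty)
    (hB : ∀ b ∈ B, ∀ b' ∈ B, ∀ i : Fin n, (i : ℕ) < n - t → b i = b' i)
    (S : Finset ((Fin n → Fin d) × (Fin n → Fin d)))
    (h1 : ∀ p ∈ S, p.1 ≠ a ∧ p.2 ∉ B)
    (h2 : ∀ p ∈ S, ∀ q ∈ S, p ≠ q → p.2 ≠ q.2)
    (h3 : ∀ p ∈ S, ∀ q ∈ S, p ≠ q → p.1 = q.1 →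
      ¬ (∀ i : Fin n, (i : ℕ) < n - t → p.2 i = q.2 i))
    (h4 : ∀ p ∈ S, ∃ b ∈ B, n - 1 ≤ strSuf d n p.1 a + strPre d n p.2 b) :
    (2 * t < n →
      S.card ≤ d ^ (n - 2 * t) + t * (d - 1) * d ^ (n - t) - 1) ∧
    (2 * t = n →
      S.card ≤ ((n - t) * (d - 1) - 1) * d ^ (n - t) + d ^ t) ∧
    (n < 2 * t →
      (S.card : ℚ) <
        (((n : ℚ) - (t : ℚ)) * ((d : ℚ) - 1) - 1) * (d : ℚ) ^ (n - t)
          + (d : ℚ) ^ t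
          - ((d : ℚ) - 1) * (d : ℚ) ^ (2 * (t : ℤ) - (n : ℤ) - 2) + 1) := by
  classical
  obtain ⟨b0, hb0⟩ := hBne
  have hdpos : 0 < d := by omega
  -- simplified blocking condition
  have key : ∀ p ∈ S, ∀ m : ℕ, (∀ b ∈ B, ¬ (∀ i : Fin n, (i : ℕ) < m + 1 → p.2 i = b i)) →
      p.1 ∈ (ucyl a m).erase a := by
    intro p hp m hm
    rw [Finset.mem_erase, mem_ucyl]
    refine ⟨(h1 p hp).1, ?_⟩
    obtain ⟨b, hb, hle⟩ := h4 p hp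
    have hpre := aux_pre hn p.2 b
    have hsuf := aux_suf hn p.1 a
    have hlt : strPre d n p.2 b < m + 1 := by
      by_contra hc
      exact hm b hb fun i hi => hpre.2 i (by omega)
    intro i hi hi'
    exact hsuf i (by omega) hi'
  have cardU : ∀ m, m < n → ((ucyl a m).erase a).card = d ^ (m + 1) - 1 := by
    intro m hm
    rw [Finset.card_erase_of_mem (by rw [mem_ucyl]; intros; rfl), card_ucyl a m hm]
  -- injectivity
  have inj2 : ∀ T ⊆ S, Set.InjOn Prod.snd (T : Set ((Fin n → Fin d) × (Fin n → Fin d))) := by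
    intro T hT p hp q hq h
    by_contra hne
    exact h2 p (hT hp) q (hT hq) hne h
  have inj1 : ∀ c : Fin n → Fin d, ∀ T ⊆ S, (∀ p ∈ T, p.2 ∈ cyl c (n - t)) →
      Set.InjOn Prod.fst (T : Set ((Fin n → Fin d) × (Fin n → Fin d))) := by
    intro c T hT hc p hp q hq h
    by_contra hne
    refine h3 p (hT hp) q (hT hq) hne h fun i hi => ?_
    rw [(mem_cyl _ _ _).1 (hc p hp) i hi, (mem_cyl _ _ _).1 (hc q hq) i hi]
  -- outside
  let T : ℕ → Finset ((Fin n → Fin d) × (Fin n → Fin d)) := fun j =>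
    S.filter (fun p => (∀ i : Fin n, (i : ℕ) < j → p.2 i = b0 i) ∧
      ∀ i : Fin n, (i : ℕ) = j → p.2 i ≠ b0 i)
  let Tin := S.filter (fun p => p.2 ∈ cyl b0 (n - t))
  let r : (Fin n → Fin d) → (Fin (n - t) → Fin d) := fun f i => f (Fin.castLE (Nat.sub_le n t) i)
  have hsub : S ⊆ (Finset.range (n - t)).biUnion T ∪ Tin := by
    intro p hp
    rw [Finset.mem_union, Finset.mem_biUnion]
    by_cases h : p.2 ∈ cyl b0 (n - t)
    · right; exact Finset.mem_filter.2 ⟨hp, h⟩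
    · left
      rw [mem_cyl] at h
      push Not at h
      have hex : ∃ k : ℕ, ∃ i : Fin n, (i : ℕ) = k ∧ p.2 i ≠ b0 i := by
        obtain ⟨i, _, hi⟩ := h
        exact ⟨i, i, rfl, hi⟩
      have hfind := Nat.find_spec hex
      have hmin := fun m (hm : m < Nat.find hex) => Nat.find_min hex hm
      obtain ⟨i, hi, hi'⟩ := h
      have hle : Nat.find hex ≤ i := Nat.find_min' hex ⟨i, rfl, hi'⟩
      refine ⟨Nat.find hex, Finset.mem_range.2 (by omega), Finset.mem_filter.2 ⟨hp, ?_, ?_⟩⟩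
      · intro k hk
        by_contra hc
        exact hmin _ hk ⟨k, rfl, hc⟩
      · intro k hk
        obtain ⟨i2, e, h'⟩ := hfind
        have : k = i2 := Fin.ext (by omega)
        rw [this]; exact h'
  have hT : ∀ j, j < n - t → ((T j).card : ℤ) ≤
      (if j < t then (d : ℤ) ^ (j + 1) - 1 else (d : ℤ) ^ t) *
        (((d : ℤ) - 1) * (d : ℤ) ^ (n - t - 1 - j)) := by
    intro j hj
    have hmain : (T j).card ≤ (if j < t then d ^ (j + 1) - 1 else d ^ t) * (lev (r b0) j).card := by
      apply Finset.card_le_mul_card_image_of_maps_to (f := fun p => r p.2)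
      · intro p hp
        obtain ⟨_, ha, hb⟩ := Finset.mem_filter.1 hp
        exact mem_lev _ _ _ (fun i hi => ha _ hi) (fun i hi => hb _ hi)
      · intro w hw
        rcases Finset.eq_empty_or_nonempty ((T j).filter (fun p => r p.2 = w)) with he | ⟨p0, hp0⟩
        · rw [he]; simp
        have hS : (T j).filter (fun p => r p.2 = w) ⊆ S :=
          (Finset.filter_subset _ _).trans (Finset.filter_subset _ _)
        have hcy : ∀ p ∈ (T j).filter (fun p => r p.2 = w), p.2 ∈ cyl p0.2 (n - t) := by
          intro p hp
          rw [mem_cyl]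
          intro i hi
          have e : r p.2 = r p0.2 :=
            (Finset.mem_filter.1 hp).2.trans (Finset.mem_filter.1 hp0).2.symm
          exact congrFun e ⟨i, hi⟩
        split_ifs with hjt
        · rw [← cardU j (by omega)]
          refine Finset.card_le_card_of_injOn Prod.fst ?_ (inj1 p0.2 _ hS hcy)
          intro p hp
          refine key p (hS hp) j ?_
          intro b hb hall
          obtain ⟨_, _, hne⟩ := Finset.mem_filter.1 (Finset.mem_filter.1 hp).1
          have hjn : j < n := by omega
          apply hne ⟨j, hjn⟩ rfl
          rw [hall ⟨j, hjn⟩ (by simp)]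
          exact hB b hb b0 hb0 _ hj
        · have := card_cyl p0.2 (n - t) (Nat.sub_le n t)
          have e : n - (n - t) = t := by omega
          rw [e] at this
          rw [← this]
          exact Finset.card_le_card_of_injOn Prod.snd (fun p hp => hcy p hp) (inj2 _ hS)
    rw [card_lev _ _ hj] at hmain
    have hm : ((T j).card : ℤ) ≤ _ := Int.ofNat_le.2 hmain
    refine hm.trans (le_of_eq ?_)
    have e1 : 1 ≤ d ^ (j + 1) := Nat.one_le_pow _ _ hdpos
    have e2 : 1 ≤ d := hdpos
    split_ifs <;> push_cast [e1, e2] <;> rfl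
  have hcard : (S.card : ℤ) ≤
      FF d (fun j => if j < t then (d : ℤ) ^ (j + 1) - 1 else (d : ℤ) ^ t) (n - t)
        + Tin.card := by
    have h := (Finset.card_le_card hsub).trans (Finset.card_union_le _ _)
    have h' := h.trans (Nat.add_le_add_right (Finset.card_biUnion_le) _)
    have h'' : (S.card : ℤ) ≤ ((∑ j ∈ Finset.range (n - t), (T j).card : ℕ) : ℤ) + Tin.card := by
      exact_mod_cast h'
    refine h''.trans ?_
    push_cast
    refine add_le_add_left (Finset.sum_le_sum fun j hj => hT j (Finset.mem_range.1 hj)) _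
  -- inside
  have hTinS : Tin ⊆ S := Finset.filter_subset _ _
  have hBcyl : B ⊆ cyl b0 (n - t) := fun b hb => (mem_cyl _ _ _).2 (hB b hb b0 hb0)
  have hin1 : Tin.card + B.card ≤ d ^ t := by
    have h : Tin.card ≤ (cyl b0 (n - t) \ B).card := by
      refine Finset.card_le_card_of_injOn Prod.snd ?_ (inj2 _ hTinS)
      intro p hp
      obtain ⟨hp1, hp2⟩ := Finset.mem_filter.1 hp
      exact Finset.mem_coe.2 (Finset.mem_sdiff.2 ⟨hp2, (h1 p hp1).2⟩)
    rw [Finset.card_sdiff_of_subset hBcyl, card_cyl _ _ (Nat.sub_le n t)] at h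
    have e : n - (n - t) = t := by omega
    have hle := Finset.card_le_card hBcyl
    rw [card_cyl _ _ (Nat.sub_le n t)] at hle
    rw [e] at h hle
    omega
  have hBpos : 1 ≤ B.card := Finset.card_pos.2 ⟨b0, hb0⟩
  have hin1' : (Tin.card : ℤ) + B.card ≤ (d : ℤ) ^ t := by exact_mod_cast hin1
  have hBpos' : (1 : ℤ) ≤ B.card := by exact_mod_cast hBpos
  refine ⟨fun hlt => ?_, fun heq => ?_, fun hgt => ?_⟩
  · obtain ⟨k, hk⟩ : ∃ k, n - t = t + k := ⟨n - 2 * t, by omega⟩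
    rw [hk, FF_big] at hcard
    have hk2 : n - 2 * t = k := by omega
    rw [hk, hk2]
    apply Nat.le_sub_of_add_le
    zify
    rw [Nat.cast_sub (by omega)]
    push_cast
    linarith
  · rw [FF_small d t (n - t) (by omega)] at hcard
    have e : 1 ≤ (n - t) * (d - 1) := Nat.mul_pos (by omega) (by omega)
    zify
    rw [Nat.cast_sub e, Nat.cast_mul, Nat.cast_sub (by omega : 1 ≤ d)]
    push_cast
    linarith
  · rw [FF_small d t (n - t) (by omega)] at hcard
    have hcardQ : (S.card : ℚ) ≤ ((n : ℚ) - t) * ((d : ℚ) - 1) * (d : ℚ) ^ (n - t)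
        - (d : ℚ) ^ (n - t) + 1 + Tin.card := by
      rw [Nat.cast_sub (by omega)] at hcard
      exact_mod_cast hcard
    suffices hX : (Tin.card : ℚ) + ((d : ℚ) - 1) * (d : ℚ) ^ (2 * (t : ℤ) - (n : ℤ) - 2)
        < (d : ℚ) ^ t by linarith
    have hin1Q : (Tin.card : ℚ) + B.card ≤ (d : ℚ) ^ t := by exact_mod_cast hin1
    have hdQ : (2 : ℚ) ≤ d := by exact_mod_cast hd
    rcases Nat.lt_or_ge (2 * t) (n + 2) with hs | hs
    · have e : 2 * (t : ℤ) - (n : ℤ) - 2 = -1 := by omega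
      rw [e, zpow_neg_one]
      have hBQ : (1 : ℚ) ≤ B.card := by exact_mod_cast hBpos
      have : ((d : ℚ) - 1) * (d : ℚ)⁻¹ < 1 := by
        rw [← div_eq_mul_inv, div_lt_one (by linarith)]
        linarith
      linarith
    · obtain ⟨s, hs'⟩ := Nat.exists_eq_add_of_le hs
      have e : 2 * (t : ℤ) - (n : ℤ) - 2 = (s : ℤ) := by omega
      rw [e, zpow_natCast]
      -- reduce to integers
      suffices hZ : (Tin.card : ℤ) + ((d : ℤ) - 1) * (d : ℤ) ^ s < (d : ℤ) ^ t by
        exact_mod_cast hZ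
      rcases lt_or_ge (((d : ℤ) - 1) * (d : ℤ) ^ s) (B.card : ℤ) with hb | hb
      · linarith
      have hin2 : Tin.card ≤ (B.card * d ^ (n - t + 1) - B.card) + (d ^ (t - 1) - 1) := by
        let P : ((Fin n → Fin d) × (Fin n → Fin d)) → Prop :=
          fun p => p.2 ∈ B.biUnion (fun b => cyl b (t - 1))
        rw [← Finset.card_filter_add_card_filter_not (s := Tin) P]
        refine add_le_add ?_ ?_
        · have hBs : B ⊆ B.biUnion (fun b => cyl b (t - 1)) := fun b hb =>
            Finset.mem_biUnion.2 ⟨b, hb, (mem_cyl _ _ _).2 (fun _ _ => rfl)⟩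
          have h : (Tin.filter P).card ≤ (B.biUnion (fun b => cyl b (t - 1)) \ B).card := by
            refine Finset.card_le_card_of_injOn Prod.snd ?_
              (inj2 _ ((Finset.filter_subset _ _).trans hTinS))
            intro p hp
            obtain ⟨hp1, hp2⟩ := Finset.mem_filter.1 hp
            exact Finset.mem_coe.2 (Finset.mem_sdiff.2 ⟨hp2, (h1 p (hTinS hp1)).2⟩)
          rw [Finset.card_sdiff_of_subset hBs] at h
          refine h.trans (Nat.sub_le_sub_right ?_ _)
          apply Finset.card_biUnion_le_card_mul
          intro b _
          rw [card_cyl _ _ (by omega)]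
          exact le_of_eq (congrArg _ (by omega))
        · have e2 : t - 1 = (t - 2) + 1 := by omega
          have hU := cardU (t - 2) (by omega)
          rw [← e2] at hU
          rw [← hU]
          refine Finset.card_le_card_of_injOn Prod.fst ?_
              (inj1 b0 _ ((Finset.filter_subset _ _).trans hTinS) ?_)
          · intro p hp
            obtain ⟨hp1, hp2⟩ := Finset.mem_filter.1 hp
            refine key p (hTinS hp1) _ ?_
            intro b hb hall
            apply hp2
            refine Finset.mem_biUnion.2 ⟨b, hb, (mem_cyl _ _ _).2 ?_⟩
            rw [e2]; exact hall
          · intro p hp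
            exact (Finset.mem_filter.1 (Finset.mem_filter.1 hp).1).2
      have p1 : 1 ≤ d ^ (n - t + 1) := Nat.one_le_pow _ _ hdpos
      have p2 : 1 ≤ d ^ (t - 1) := Nat.one_le_pow _ _ hdpos
      have p3 : B.card ≤ B.card * d ^ (n - t + 1) := Nat.le_mul_of_pos_right _ p1
      have hin2Z : (Tin.card : ℤ) ≤
          (B.card : ℤ) * ((d : ℤ) ^ (n - t + 1) - 1) + ((d : ℤ) ^ (t - 1) - 1) := by
        have := Int.ofNat_le.2 hin2
        push_cast [p1, p2, p3] at this
        linarith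
      have p1Z : (0 : ℤ) ≤ (d : ℤ) ^ (n - t + 1) - 1 := by
        have : (1 : ℤ) ≤ (d : ℤ) ^ (n - t + 1) := by exact_mod_cast p1
        linarith
      have hm := mul_le_mul_of_nonneg_right hb p1Z
      have e3 : (d : ℤ) ^ s * (d : ℤ) ^ (n - t + 1) = (d : ℤ) ^ (t - 1) := by
        rw [← pow_add]; congr 1; omega
      have e4 : (d : ℤ) ^ t = d * (d : ℤ) ^ (t - 1) := by
        rw [← pow_succ']; congr 1; omega
      have e5 : ((d : ℤ) - 1) * (d : ℤ) ^ s * ((d : ℤ) ^ (n - t + 1) - 1)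
          = ((d : ℤ) - 1) * (d : ℤ) ^ (t - 1) - ((d : ℤ) - 1) * (d : ℤ) ^ s := by
        rw [← e3]; ring
      rw [e5] at hm
      rw [e4]
      linarith
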